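/- In the coordinate hypersurface-variation setup, let k_t := Σ_{a,b} (h_t)^{ab} (K_t)_{ab} be the trace (with respect to h_t) of the extrinsic curvature of φ_t with normal n_t. Define Tr_h(K²) := Σ_{a,b,c,d} h^{ab} K_{bc} h^{cd} K_{da}, Ric_{αβ} := Σ_λ R^λ_{αλβ} with R^λ_{αμβ} := ∂_μ Γ^λ_{αβ} − ∂_β Γ^λ_{αμ} + Σ_σ ( Γ^λ_{σμ} Γ^σ_{αβ} − Γ^λ_{σβ} Γ^σ_{αμ} ), and Δ^Σ f := Σ_{a,b} h^{ab} ( ∂_a ∂_b f − Σ_c Γ^{Σ,c}_{ab} ∂_c f ) where Γ^{Σ,c}_{ab} are the Christoffel symbols of h := h₀. Then at every point of U, ∂_t k_t |_{t=0} = − f Tr_h(K²) − f Σ_{α,β} Ric_{αβ}(φ₀) n₀^α n₀^β − ϵ Δ^Σ f + Σ_a X^a ∂_a k. -/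

import Mathlib

noncomputable section

/-- The partial derivative `∂_a f` of a function on `ℝ^N` in the `a`-th coordinate
direction. -/
def pder {N : ℕ} (f : (Fin N → ℝ) → ℝ) (a : Fin N) (x : Fin N → ℝ) : ℝ :=
  fderiv ℝ f x (Pi.single a 1)

/-- The pointwise inverse components `g^{μν}` of a metric given in components. -/
def ginv {N : ℕ} (g : (Fin N → ℝ) → Fin N → Fin N → ℝ) (x : Fin N → ℝ)
    (μ ν : Fin N) : ℝ :=
  (Matrix.of (g x))⁻¹ μ ν

/-- The Christoffel symbols
`Γ^l_{μν} = (1/2) Σ_σ g^{lσ} (∂_μ g_{σν} + ∂_ν g_{σμ} − ∂_σ g_{μν})` of the metric `g`. -/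
def christoffel {N : ℕ} (g : (Fin N → ℝ) → Fin N → Fin N → ℝ) (x : Fin N → ℝ)
    (l μ ν : Fin N) : ℝ :=
  (1 / 2) * ∑ σ, ginv g x l σ *
    (pder (fun z => g z σ ν) μ x + pder (fun z => g z σ μ) ν x
      - pder (fun z => g z μ ν) σ x)

/-- The spatial derivative `∂_a φ_t^μ` of the hypersurface family. -/
def Dphi {n : ℕ} (φ : ℝ → (Fin n → ℝ) → Fin (n + 1) → ℝ) (t : ℝ) (y : Fin n → ℝ)
    (a : Fin n) (μ : Fin (n + 1)) : ℝ :=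
  pder (fun z => φ t z μ) a y

/-- The induced metric `(h_t)_{ab} = Σ_{μν} g_{μν}(φ_t) ∂_aφ_t^μ ∂_bφ_t^ν`. -/
def indMet {n : ℕ} (g : (Fin (n + 1) → ℝ) → Fin (n + 1) → Fin (n + 1) → ℝ)
    (φ : ℝ → (Fin n → ℝ) → Fin (n + 1) → ℝ) (t : ℝ) (y : Fin n → ℝ)
    (a b : Fin n) : ℝ :=
  ∑ μ, ∑ ν, g (φ t y) μ ν * Dphi φ t y a μ * Dphi φ t y b ν

/-- The inverse `(h_t)^{ab}` of the induced metric. -/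
def indMetInv {n : ℕ} (g : (Fin (n + 1) → ℝ) → Fin (n + 1) → Fin (n + 1) → ℝ)
    (φ : ℝ → (Fin n → ℝ) → Fin (n + 1) → ℝ) (t : ℝ) (y : Fin n → ℝ)
    (a b : Fin n) : ℝ :=
  (Matrix.of (fun a b => indMet g φ t y a b))⁻¹ a b

/-- The extrinsic curvature
`(K_t)_{ab} = Σ_{μν} g_{μν}(φ_t) ∂_aφ_t^μ (∂_b n_t^ν + Σ_{lσ} Γ^ν_{lσ}(φ_t) ∂_bφ_t^l n_t^σ)`. -/
def extK {n : ℕ} (g : (Fin (n + 1) → ℝ) → Fin (n + 1) → Fin (n + 1) → ℝ)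
    (φ nrm : ℝ → (Fin n → ℝ) → Fin (n + 1) → ℝ) (t : ℝ) (y : Fin n → ℝ)
    (a b : Fin n) : ℝ :=
  ∑ μ, ∑ ν, g (φ t y) μ ν * Dphi φ t y a μ *
    (pder (fun z => nrm t z ν) b y
      + ∑ l, ∑ σ, christoffel g (φ t y) ν l σ * Dphi φ t y b l * nrm t y σ)

/-- The trace `k_t = (h_t)^{ab} (K_t)_{ab}` of the extrinsic curvature. -/
def trExtK {n : ℕ} (g : (Fin (n + 1) → ℝ) → Fin (n + 1) → Fin (n + 1) → ℝ)
    (φ nrm : ℝ → (Fin n → ℝ) → Fin (n + 1) → ℝ) (t : ℝ) (y : Fin n → ℝ) : ℝ :=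
  ∑ a, ∑ b, indMetInv g φ t y a b * extK g φ nrm t y a b

/-- The Riemann curvature components
`R^l_{αμβ} = ∂_μ Γ^l_{αβ} − ∂_β Γ^l_{αμ} + Σ_σ (Γ^l_{σμ} Γ^σ_{αβ} − Γ^l_{σβ} Γ^σ_{αμ})`. -/
def riemann {N : ℕ} (g : (Fin N → ℝ) → Fin N → Fin N → ℝ) (x : Fin N → ℝ)
    (l α μ β : Fin N) : ℝ :=
  pder (fun z => christoffel g z l α β) μ x
    - pder (fun z => christoffel g z l α μ) β x
    + ∑ σ, (christoffel g x l σ μ * christoffel g x σ α β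
        - christoffel g x l σ β * christoffel g x σ α μ)

/-- The lowered Riemann tensor `R_{μανβ} = Σ_l g_{μl} R^l_{ανβ}`. -/
def riemannLow {N : ℕ} (g : (Fin N → ℝ) → Fin N → Fin N → ℝ) (x : Fin N → ℝ)
    (μ α ν β : Fin N) : ℝ :=
  ∑ l, g x μ l * riemann g x l α ν β

/-- The Ricci tensor `Ric_{αβ} = Σ_l R^l_{αlβ}`. -/
def ricci {N : ℕ} (g : (Fin N → ℝ) → Fin N → Fin N → ℝ) (x : Fin N → ℝ)
    (α β : Fin N) : ℝ :=
  ∑ l, riemann g x l α l β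

/-- The Christoffel symbols `Γ^{Σ,c}_{ab}` of the induced metric `h₀`. -/
def christoffelInd {n : ℕ} (g : (Fin (n + 1) → ℝ) → Fin (n + 1) → Fin (n + 1) → ℝ)
    (φ : ℝ → (Fin n → ℝ) → Fin (n + 1) → ℝ) (y : Fin n → ℝ) (c a b : Fin n) : ℝ :=
  (1 / 2) * ∑ d, indMetInv g φ 0 y c d *
    (pder (fun z => indMet g φ 0 z d b) a y + pder (fun z => indMet g φ 0 z d a) b y
      - pder (fun z => indMet g φ 0 z a b) d y)

section Covariant

variable {E F H : Type*} [NormedAddCommGroup E] [NormedSpace ℝ E]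
  [NormedAddCommGroup F] [NormedSpace ℝ F] [NormedAddCommGroup H] [NormedSpace ℝ H]

/-- The covariant derivative, in the direction `u`, of a vector field `w` along the map `Φ`, for the
connection with Christoffel symbols `Γ`. -/
def covDeriv (Γ : F → F →L[ℝ] F →L[ℝ] F) (Φ w : E → F) (u : E) (q : E) : F :=
  fderiv ℝ w q u + Γ (Φ q) (fderiv ℝ Φ q u) (w q)

/-- The curvature of the connection with Christoffel symbols `Γ`. -/
def curvOp (Γ : F → F →L[ℝ] F →L[ℝ] F) (x u v w : F) : F :=
  fderiv ℝ Γ x u v w - fderiv ℝ Γ x v u w + (Γ x u (Γ x v w) - Γ x v (Γ x u w))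

theorem fderiv_bilin_comp {B : F → F →L[ℝ] F →L[ℝ] H} {Φ w z : E → F} {q : E}
    (hB : DifferentiableAt ℝ B (Φ q)) (hΦ : DifferentiableAt ℝ Φ q)
    (hw : DifferentiableAt ℝ w q) (hz : DifferentiableAt ℝ z q) :
    HasFDerivAt (fun p => B (Φ p) (w p) (z p))
      (fderiv ℝ (fun p => B (Φ p) (w p) (z p)) q) q ∧
    ∀ u, fderiv ℝ (fun p => B (Φ p) (w p) (z p)) q u
      = fderiv ℝ B (Φ q) (fderiv ℝ Φ q u) (w q) (z q) + B (Φ q) (fderiv ℝ w q u) (z q)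
        + B (Φ q) (w q) (fderiv ℝ z q u) := by
  have h₁ : HasFDerivAt (fun p => B (Φ p)) ((fderiv ℝ B (Φ q)).comp (fderiv ℝ Φ q)) q :=
    HasFDerivAt.comp (G := F →L[ℝ] F →L[ℝ] H) q hB.hasFDerivAt hΦ.hasFDerivAt
  have h₂ : HasFDerivAt (fun p => B (Φ p) (w p)) _ q := h₁.clm_apply hw.hasFDerivAt
  have h : HasFDerivAt (fun p => B (Φ p) (w p) (z p)) _ q := h₂.clm_apply hz.hasFDerivAt
  refine ⟨h.differentiableAt.hasFDerivAt, fun u => ?_⟩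
  rw [h.fderiv]
  simp
  abel

theorem fderiv_metric_comp {G : F → F →L[ℝ] F →L[ℝ] ℝ} {Γ : F → F →L[ℝ] F →L[ℝ] F}
    {Φ w z : E → F} {q : E}
    (hG : DifferentiableAt ℝ G (Φ q)) (hΦ : DifferentiableAt ℝ Φ q)
    (hw : DifferentiableAt ℝ w q) (hz : DifferentiableAt ℝ z q)
    (hcompat : ∀ u v v', fderiv ℝ G (Φ q) u v v'
      = G (Φ q) (Γ (Φ q) u v) v' + G (Φ q) v (Γ (Φ q) u v')) (u : E) :
    fderiv ℝ (fun p => G (Φ p) (w p) (z p)) q u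
      = G (Φ q) (covDeriv Γ Φ w u q) (z q) + G (Φ q) (w q) (covDeriv Γ Φ z u q) := by
  rw [(fderiv_bilin_comp hG hΦ hw hz).2, hcompat]
  simp only [covDeriv, map_add, add_apply]
  abel

theorem covDeriv_fderiv_comm {Γ : F → F →L[ℝ] F →L[ℝ] F} {Φ : E → F} {q : E}
    (hΦ : ContDiffAt ℝ 2 Φ q) (hΓ : ∀ u v, Γ (Φ q) u v = Γ (Φ q) v u) (u v : E) :
    covDeriv Γ Φ (fun p => fderiv ℝ Φ p v) u q = covDeriv Γ Φ (fun p => fderiv ℝ Φ p u) v q := by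
  have hd : DifferentiableAt ℝ (fderiv ℝ Φ) q :=
    (hΦ.fderiv_right (m := 1) (by norm_num)).differentiableAt (by norm_num)
  have hs := hΦ.isSymmSndFDerivAt (by simp) u v
  have h1 : ∀ v, fderiv ℝ (fun p => fderiv ℝ Φ p v) q = (fderiv ℝ (fderiv ℝ Φ) q).flip v := by
    intro v
    have := hd.hasFDerivAt.clm_apply (hasFDerivAt_const v q)
    rw [this.fderiv]
    simp
  simp only [covDeriv, h1, ContinuousLinearMap.flip_apply]
  rw [hs, hΓ]

theorem covDeriv_covDeriv_sub {Γ : F → F →L[ℝ] F →L[ℝ] F} {Φ w : E → F} {q : E}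
    (hΓ : DifferentiableAt ℝ Γ (Φ q)) (hΦ : ContDiffAt ℝ 2 Φ q) (hw : ContDiffAt ℝ 2 w q)
    (u v : E) :
    covDeriv Γ Φ (covDeriv Γ Φ w v) u q - covDeriv Γ Φ (covDeriv Γ Φ w u) v q
      = curvOp Γ (Φ q) (fderiv ℝ Φ q u) (fderiv ℝ Φ q v) (w q) := by
  have hd : ∀ {f : E → F}, ContDiffAt ℝ 2 f q → DifferentiableAt ℝ (fderiv ℝ f) q := fun hf =>
    (hf.fderiv_right (m := 1) (by norm_num)).differentiableAt (by norm_num)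
  have h1 : ∀ {f : E → F}, ContDiffAt ℝ 2 f q → ∀ v,
      HasFDerivAt (fun p => fderiv ℝ f p v) ((fderiv ℝ (fderiv ℝ f) q).flip v) q := by
    intro f hf v
    simpa using (hd hf).hasFDerivAt.clm_apply (hasFDerivAt_const v q)
  have h2 : ∀ u v, fderiv ℝ (covDeriv Γ Φ w v) q u = fderiv ℝ (fderiv ℝ w) q u v
      + (fderiv ℝ Γ (Φ q) (fderiv ℝ Φ q u) (fderiv ℝ Φ q v) (w q)
        + Γ (Φ q) (fderiv ℝ (fderiv ℝ Φ) q u v) (w q)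
        + Γ (Φ q) (fderiv ℝ Φ q v) (fderiv ℝ w q u)) := by
    intro u v
    have hb := fderiv_bilin_comp hΓ (hΦ.differentiableAt (by norm_num))
      (h1 hΦ v).differentiableAt (hw.differentiableAt (by norm_num))
    have := (h1 hw v).add hb.1
    rw [show covDeriv Γ Φ w v = (fun p => fderiv ℝ w p v)
      + fun p => Γ (Φ p) (fderiv ℝ Φ p v) (w p) from rfl, this.fderiv,
      add_apply, hb.2, (h1 hΦ v).fderiv]
    rfl
  have hs := hΦ.isSymmSndFDerivAt (by simp) u v
  have hs' := hw.isSymmSndFDerivAt (by simp) u v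
  change fderiv ℝ (covDeriv Γ Φ w v) q u + _ - (fderiv ℝ (covDeriv Γ Φ w u) q v + _) = _
  rw [h2, h2, hs, hs']
  simp only [covDeriv, curvOp, map_add]
  abel

theorem covDeriv_differentiableAt {Γ : F → F →L[ℝ] F →L[ℝ] F} {Φ w : E → F} {q : E}
    (hΓ : DifferentiableAt ℝ Γ (Φ q)) (hΦ : ContDiffAt ℝ 2 Φ q) (hw : ContDiffAt ℝ 2 w q)
    (v : E) : DifferentiableAt ℝ (covDeriv Γ Φ w v) q := by
  have hd : ∀ {f : E → F}, ContDiffAt ℝ 2 f q → DifferentiableAt ℝ (fun p => fderiv ℝ f p v) q :=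
    fun hf => ((hf.fderiv_right (m := 1) (by norm_num)).differentiableAt (by norm_num)).clm_apply
      (differentiableAt_const v)
  exact (hd hw).add (fderiv_bilin_comp hΓ (hΦ.differentiableAt (by norm_num)) (hd hΦ)
    (hw.differentiableAt (by norm_num))).1.differentiableAt

theorem covDeriv_add {Γ : F → F →L[ℝ] F →L[ℝ] F} {Φ w z : E → F} {q : E}
    (hw : DifferentiableAt ℝ w q) (hz : DifferentiableAt ℝ z q) (u : E) :
    covDeriv Γ Φ (fun p => w p + z p) u q = covDeriv Γ Φ w u q + covDeriv Γ Φ z u q := by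
  simp only [covDeriv, fderiv_fun_add hw hz, add_apply, map_add]
  abel

theorem covDeriv_smul {Γ : F → F →L[ℝ] F →L[ℝ] F} {Φ w : E → F} {c : E → ℝ} {q : E}
    (hc : DifferentiableAt ℝ c q) (hw : DifferentiableAt ℝ w q) (u : E) :
    covDeriv Γ Φ (fun p => c p • w p) u q
      = fderiv ℝ c q u • w q + c q • covDeriv Γ Φ w u q := by
  simp only [covDeriv, fderiv_fun_smul hc hw, add_apply, smul_apply,
    ContinuousLinearMap.smulRight_apply, map_smul, smul_add]
  abel

theorem covDeriv_sum {ι : Type*} [Fintype ι] {Γ : F → F →L[ℝ] F →L[ℝ] F} {Φ : E → F}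
    {w : ι → E → F} {q : E} (hw : ∀ i, DifferentiableAt ℝ (w i) q) (u : E) :
    covDeriv Γ Φ (fun p => ∑ i, w i p) u q = ∑ i, covDeriv Γ Φ (w i) u q := by
  simp only [covDeriv, fderiv_fun_sum fun i _ => hw i, sum_apply, map_sum,
    Finset.sum_add_distrib]

theorem curvOp_self (Γ : F → F →L[ℝ] F →L[ℝ] F) (x u w : F) : curvOp Γ x u u w = 0 := by
  simp [curvOp]

end Covariant
section Components

variable {N : ℕ}

/-- The bilinear map with values in `ℝ` and components `c`. -/
def formOf (c : Fin N → Fin N → ℝ) : (Fin N → ℝ) →L[ℝ] (Fin N → ℝ) →L[ℝ] ℝ :=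
  ∑ i, ∑ j, c i j • (ContinuousLinearMap.proj (R := ℝ) (φ := fun _ : Fin N => ℝ) i).smulRight
    (ContinuousLinearMap.proj (R := ℝ) (φ := fun _ : Fin N => ℝ) j)

theorem formOf_apply (c : Fin N → Fin N → ℝ) (u v : Fin N → ℝ) :
    formOf c u v = ∑ i, ∑ j, c i j * u i * v j := by
  simp [formOf, mul_assoc]

/-- The bilinear map `(u, v) ↦ Σ_{ij} c^l_{ij} v^i u^j`. -/
def bilinOf (c : Fin N → Fin N → Fin N → ℝ) :
    (Fin N → ℝ) →L[ℝ] (Fin N → ℝ) →L[ℝ] (Fin N → ℝ) :=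
  ∑ l, ∑ i, ∑ j, c l i j •
    (ContinuousLinearMap.proj (R := ℝ) (φ := fun _ : Fin N => ℝ) j).smulRight
      ((ContinuousLinearMap.proj (R := ℝ) (φ := fun _ : Fin N => ℝ) i).smulRight
        (Pi.single l (1 : ℝ) : Fin N → ℝ))

theorem bilinOf_apply (c : Fin N → Fin N → Fin N → ℝ) (u v : Fin N → ℝ) (l : Fin N) :
    bilinOf c u v l = ∑ i, ∑ j, c l i j * v i * u j := by
  simp only [bilinOf, sum_apply, Finset.sum_apply,
    smul_apply, ContinuousLinearMap.smulRight_apply, Pi.smul_apply,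
    ContinuousLinearMap.proj_apply, smul_eq_mul]
  rw [Finset.sum_eq_single l]
  · simp; exact Finset.sum_congr rfl fun i _ => Finset.sum_congr rfl fun j _ => by ring
  · intro b _ hb; simp [hb.symm]
  · simp

theorem hasFDerivAt_sum_smul {E H ι : Type*} [NormedAddCommGroup E] [NormedSpace ℝ E]
    [NormedAddCommGroup H] [NormedSpace ℝ H] [Fintype ι] {c : E → ι → ℝ} {x : E} (M : ι → H)
    (hc : ∀ i, DifferentiableAt ℝ (fun z => c z i) x) :
    DifferentiableAt ℝ (fun z => ∑ i, c z i • M i) x ∧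
    ∀ u, fderiv ℝ (fun z => ∑ i, c z i • M i) x u = ∑ i, fderiv ℝ (fun z => c z i) x u • M i := by
  have h : HasFDerivAt (fun z => ∑ i, c z i • M i)
      (∑ i, (fderiv ℝ (fun z => c z i) x).smulRight (M i)) x :=
    HasFDerivAt.fun_sum fun i _ => (hc i).hasFDerivAt.smul_const _
  refine ⟨h.differentiableAt, fun u => ?_⟩
  rw [h.fderiv]
  simp

theorem hasFDerivAt_formOf {E : Type*} [NormedAddCommGroup E] [NormedSpace ℝ E]
    {c : E → Fin N → Fin N → ℝ} {x : E}
    (hc : ∀ i j, DifferentiableAt ℝ (fun z => c z i j) x) :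
    DifferentiableAt ℝ (fun z => formOf (c z)) x ∧
    ∀ u, fderiv ℝ (fun z => formOf (c z)) x u
      = formOf (fun i j => fderiv ℝ (fun z => c z i j) x u) := by
  have h := hasFDerivAt_sum_smul (ι := Fin N × Fin N) (c := fun z p => c z p.1 p.2) (x := x)
    (fun p => (ContinuousLinearMap.proj (R := ℝ) (φ := fun _ : Fin N => ℝ) p.1).smulRight
      (ContinuousLinearMap.proj (R := ℝ) (φ := fun _ : Fin N => ℝ) p.2)) fun p => hc p.1 p.2
  simp only [Fintype.sum_prod_type] at h
  exact h

theorem hasFDerivAt_bilinOf {E : Type*} [NormedAddCommGroup E] [NormedSpace ℝ E]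
    {c : E → Fin N → Fin N → Fin N → ℝ} {x : E}
    (hc : ∀ l i j, DifferentiableAt ℝ (fun z => c z l i j) x) :
    DifferentiableAt ℝ (fun z => bilinOf (c z)) x ∧
    ∀ u, fderiv ℝ (fun z => bilinOf (c z)) x u
      = bilinOf (fun l i j => fderiv ℝ (fun z => c z l i j) x u) := by
  have h := hasFDerivAt_sum_smul (ι := Fin N × Fin N × Fin N)
    (c := fun z p => c z p.1 p.2.1 p.2.2) (x := x)
    (fun p => (ContinuousLinearMap.proj (R := ℝ) (φ := fun _ : Fin N => ℝ) p.2.2).smulRight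
      ((ContinuousLinearMap.proj (R := ℝ) (φ := fun _ : Fin N => ℝ) p.2.1).smulRight
        (Pi.single p.1 (1 : ℝ) : Fin N → ℝ))) fun p => hc p.1 p.2.1 p.2.2
  simp only [Fintype.sum_prod_type] at h
  exact h

theorem differentiableAt_matrix_det {E ι : Type*} [NormedAddCommGroup E] [NormedSpace ℝ E]
    [Fintype ι] [DecidableEq ι] {A : E → Matrix ι ι ℝ} {x : E}
    (hA : ∀ i j, DifferentiableAt ℝ (fun z => A z i j) x) :
    DifferentiableAt ℝ (fun z => (A z).det) x := by
  simp only [Matrix.det_apply']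
  exact DifferentiableAt.fun_sum fun σ _ =>
    (HasFDerivAt.finsetProd fun i _ => (hA _ _).hasFDerivAt).differentiableAt.const_mul _

theorem differentiableAt_matrix_inv {E ι : Type*} [NormedAddCommGroup E] [NormedSpace ℝ E]
    [Fintype ι] [DecidableEq ι] {A : E → Matrix ι ι ℝ} {x : E}
    (hA : ∀ i j, DifferentiableAt ℝ (fun z => A z i j) x) (hdet : IsUnit (A x).det) (i j : ι) :
    DifferentiableAt ℝ (fun z => (A z)⁻¹ i j) x := by
  simp only [Matrix.inv_def, Matrix.smul_apply, Matrix.adjugate_apply, Ring.inverse_eq_inv',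
    smul_eq_mul]
  refine ((differentiableAt_matrix_det hA).fun_inv hdet.ne_zero).fun_mul
    (differentiableAt_matrix_det fun i' j' => ?_)
  by_cases h : i' = j
  · subst h; simp
  · simpa [Matrix.updateRow_ne h] using hA i' j'

theorem fderiv_matrix_inv_mul {E ι : Type*} [NormedAddCommGroup E] [NormedSpace ℝ E]
    [Fintype ι] [DecidableEq ι] {A : E → Matrix ι ι ℝ} {x : E}
    (hA : ∀ i j, DifferentiableAt ℝ (fun z => A z i j) x) (hdet : IsUnit (A x).det) (u : E) :
    Matrix.of (fun i j => fderiv ℝ (fun z => (A z)⁻¹ i j) x u) * A x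
      + (A x)⁻¹ * Matrix.of (fun i j => fderiv ℝ (fun z => A z i j) x u) = 0 := by
  have hinv := differentiableAt_matrix_inv hA hdet
  ext i j
  have h : HasFDerivAt (fun z => ∑ l, (A z)⁻¹ i l * A z l j) _ x :=
    HasFDerivAt.fun_sum fun l _ => (hinv i l).hasFDerivAt.mul (hA l j).hasFDerivAt
  have hev : (fun z => ∑ l, (A z)⁻¹ i l * A z l j)
      =ᶠ[nhds x] fun _ => (1 : Matrix ι ι ℝ) i j := by
    filter_upwards [(differentiableAt_matrix_det hA).continuousAt.eventually_ne hdet.ne_zero]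
      with z hz
    rw [← Matrix.mul_apply, Matrix.nonsing_inv_mul _ (isUnit_iff_ne_zero.2 hz)]
  have h0 := h.fderiv
  rw [hev.fderiv_eq] at h0
  have h1 := congrArg (fun L => L u) h0
  simp only [fderiv_fun_const, Pi.zero_apply, zero_apply, sum_apply, add_apply, smul_apply,
    smul_eq_mul, Finset.sum_add_distrib] at h1
  simp only [Matrix.add_apply, Matrix.mul_apply, Matrix.of_apply, Matrix.zero_apply]
  rw [h1, add_comm]
  simp only [mul_comm]

variable {g : (Fin N → ℝ) → Fin N → Fin N → ℝ} {V : Set (Fin N → ℝ)} {x : Fin N → ℝ}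

theorem contDiffAt_fderiv_apply {E : Type*} [NormedAddCommGroup E] [NormedSpace ℝ E]
    {F : Type*} [NormedAddCommGroup F] [NormedSpace ℝ F] {p : E → F} {q : E} {m k : WithTop ℕ∞}
    (hp : ContDiffAt ℝ k p q) (hm : m + 1 ≤ k) (v : E) :
    ContDiffAt ℝ m (fun z => fderiv ℝ p z v) q :=
  (hp.fderiv_right hm).clm_apply contDiffAt_const

theorem differentiableAt_christoffel (hg : ∀ μ ν, ContDiffAt ℝ 2 (fun z => g z μ ν) x)
    (hx : IsUnit (Matrix.of (g x)).det) (l i j : Fin N) :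
    DifferentiableAt ℝ (fun z => christoffel g z l i j) x := by
  have hp : ∀ μ ν a, DifferentiableAt ℝ (fun z => pder (fun z => g z μ ν) a z) x := fun μ ν a =>
    (contDiffAt_fderiv_apply (m := 1) (hg μ ν) (by norm_num) _).differentiableAt (by norm_num)
  have hi : ∀ μ ν, DifferentiableAt ℝ (fun z => ginv g z μ ν) x := fun μ ν =>
    differentiableAt_matrix_inv (A := fun z => Matrix.of (g z))
      (fun μ ν => (hg μ ν).differentiableAt (by norm_num)) hx μ ν
  exact (DifferentiableAt.fun_sum fun σ _ =>
    (hi l σ).mul (((hp _ _ _).add (hp _ _ _)).sub (hp _ _ _))).const_mul _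

theorem pder_metric_symm (hV : IsOpen V) (hgsym : ∀ x ∈ V, ∀ μ ν, g x μ ν = g x ν μ)
    (hx : x ∈ V) (μ ν a : Fin N) :
    pder (fun z => g z μ ν) a x = pder (fun z => g z ν μ) a x := by
  unfold pder
  rw [Filter.EventuallyEq.fderiv_eq]
  filter_upwards [hV.mem_nhds hx] with z hz using hgsym z hz μ ν

theorem christoffel_symm (hV : IsOpen V) (hgsym : ∀ x ∈ V, ∀ μ ν, g x μ ν = g x ν μ)
    (hx : x ∈ V) (l i j : Fin N) : christoffel g x l i j = christoffel g x l j i := by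
  unfold christoffel
  congr 1
  refine Finset.sum_congr rfl fun σ _ => ?_
  rw [pder_metric_symm hV hgsym hx i j]
  ring

theorem sum_metric_mul_christoffel (hx : IsUnit (Matrix.of (g x)).det) (k i j : Fin N) :
    ∑ l, g x k l * christoffel g x l i j
      = (1 / 2) * (pder (fun z => g z k j) i x + pder (fun z => g z k i) j x
        - pder (fun z => g z i j) k x) := by
  have h := Matrix.mul_nonsing_inv _ hx
  have h1 : ∀ σ, ∑ l, g x k l * ginv g x l σ = (1 : Matrix (Fin N) (Fin N) ℝ) k σ := fun σ => by
    rw [← h, Matrix.mul_apply]; rfl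
  calc _ = (1 / 2) * ∑ σ, (∑ l, g x k l * ginv g x l σ)
        * (pder (fun z => g z σ j) i x + pder (fun z => g z σ i) j x
          - pder (fun z => g z i j) σ x) := by
        simp only [christoffel, Finset.mul_sum, Finset.sum_mul]
        rw [Finset.sum_comm]
        exact Finset.sum_congr rfl fun _ _ => Finset.sum_congr rfl fun _ _ => by ring
    _ = _ := by simp [h1, Matrix.one_apply]

theorem pder_metric_eq (hV : IsOpen V) (hgsym : ∀ x ∈ V, ∀ μ ν, g x μ ν = g x ν μ)
    (hx : x ∈ V) (hu : IsUnit (Matrix.of (g x)).det) (i j a : Fin N) :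
    pder (fun z => g z i j) a x
      = ∑ l, (g x l j * christoffel g x l i a + g x i l * christoffel g x l j a) := by
  rw [Finset.sum_add_distrib, sum_metric_mul_christoffel hu]
  simp only [hgsym x hx _ j]
  rw [sum_metric_mul_christoffel hu, pder_metric_symm hV hgsym hx j i,
    pder_metric_symm hV hgsym hx i a, pder_metric_symm hV hgsym hx j a]
  ring

theorem fderiv_eq_sum_pder (p : (Fin N → ℝ) → ℝ) (x u : Fin N → ℝ) :
    fderiv ℝ p x u = ∑ a, pder p a x * u a := by
  conv_lhs => rw [pi_eq_sum_univ' u]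
  simp [pder, mul_comm]

theorem metric_compat (hV : IsOpen V) (hgsym : ∀ x ∈ V, ∀ μ ν, g x μ ν = g x ν μ)
    (hx : x ∈ V) (hu : IsUnit (Matrix.of (g x)).det)
    (hg : ∀ μ ν, DifferentiableAt ℝ (fun z => g z μ ν) x) (u v w : Fin N → ℝ) :
    fderiv ℝ (fun z => formOf (g z)) x u v w
      = formOf (g x) (bilinOf (christoffel g x) u v) w
        + formOf (g x) v (bilinOf (christoffel g x) u w) := by
  rw [(hasFDerivAt_formOf hg).2]
  simp only [formOf_apply, bilinOf_apply, fderiv_eq_sum_pder,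
    pder_metric_eq hV hgsym hx hu]
  have h1 : ∑ i, ∑ j, (∑ a, (∑ l, (g x l j * christoffel g x l i a
      + g x i l * christoffel g x l j a)) * u a) * v i * w j
      = (∑ i, ∑ j, ∑ a, ∑ l, g x l j * christoffel g x l i a * u a * v i * w j)
        + ∑ i, ∑ j, ∑ a, ∑ l, g x i l * christoffel g x l j a * u a * v i * w j := by
    simp only [Finset.sum_mul, ← Finset.sum_add_distrib, add_mul]
  rw [h1]
  congr 1
  · simp only [Finset.mul_sum, Finset.sum_mul]
    calc _ = ∑ i, ∑ j, ∑ l, ∑ a, g x l j * christoffel g x l i a * u a * v i * w j :=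
          Finset.sum_congr rfl fun i _ => Finset.sum_congr rfl fun j _ => Finset.sum_comm
      _ = ∑ j, ∑ i, ∑ l, ∑ a, g x l j * christoffel g x l i a * u a * v i * w j :=
          Finset.sum_comm
      _ = ∑ j, ∑ l, ∑ i, ∑ a, g x l j * christoffel g x l i a * u a * v i * w j :=
          Finset.sum_congr rfl fun j _ => Finset.sum_comm
      _ = ∑ l, ∑ j, ∑ i, ∑ a, g x l j * christoffel g x l i a * u a * v i * w j :=
          Finset.sum_comm
      _ = _ := by
          refine Finset.sum_congr rfl fun _ _ => Finset.sum_congr rfl fun _ _ =>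
            Finset.sum_congr rfl fun _ _ => Finset.sum_congr rfl fun _ _ => by ring
  · simp only [Finset.mul_sum]
    refine Finset.sum_congr rfl fun i _ => ?_
    calc _ = ∑ j, ∑ l, ∑ a, g x i l * christoffel g x l j a * u a * v i * w j :=
          Finset.sum_congr rfl fun j _ => Finset.sum_comm
      _ = ∑ l, ∑ j, ∑ a, g x i l * christoffel g x l j a * u a * v i * w j :=
          Finset.sum_comm
      _ = _ := by
          refine Finset.sum_congr rfl fun _ _ =>
            Finset.sum_congr rfl fun _ _ => Finset.sum_congr rfl fun _ _ => by ring

theorem riemann_eq_curvOp (hg : ∀ μ ν, ContDiffAt ℝ 2 (fun z => g z μ ν) x)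
    (hx : IsUnit (Matrix.of (g x)).det) (l α μ β : Fin N) :
    riemann g x l α μ β = curvOp (fun z => bilinOf (christoffel g z)) x
      (Pi.single μ 1) (Pi.single β 1) (Pi.single α 1) l := by
  have hc := (hasFDerivAt_bilinOf (c := christoffel g) (x := x)
    (differentiableAt_christoffel hg hx)).2
  simp [curvOp, hc, bilinOf_apply, riemann, pder, Pi.single_apply, Finset.sum_sub_distrib]

theorem sum_ricci_eq (hg : ∀ μ ν, ContDiffAt ℝ 2 (fun z => g z μ ν) x)
    (hx : IsUnit (Matrix.of (g x)).det) (u : Fin N → ℝ) :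
    ∑ α, ∑ β, ricci g x α β * u α * u β
      = -∑ l, curvOp (fun z => bilinOf (christoffel g z)) x u (Pi.single l 1) u l := by
  set R := curvOp (fun z => bilinOf (christoffel g z)) x with hR
  have h1 : ∀ u v w, R u v w = -R v u w := fun u v w => by
    simp only [hR, curvOp]; abel
  have h2 : ∀ v w w', R w v w' = ∑ β, v β • R w (Pi.single β 1) w' := fun v w w' => by
    conv_lhs => rw [pi_eq_sum_univ' v]
    simp [hR, curvOp, smul_add, smul_sub, Finset.sum_add_distrib]
  have h3 : ∀ v w w', R w w' v = ∑ α, v α • R w w' (Pi.single α 1) := fun v w w' => by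
    conv_lhs => rw [pi_eq_sum_univ' v]
    simp [hR, curvOp, smul_add, smul_sub, Finset.sum_add_distrib]
  have h4 : ∀ l, R u (Pi.single l 1) u l
      = -∑ α, ∑ β, riemann g x l α l β * u α * u β := by
    intro l
    rw [h1, h3]
    simp only [h2 u, riemann_eq_curvOp hg hx, Pi.neg_apply, Finset.sum_apply, Pi.smul_apply,
      smul_eq_mul, Finset.mul_sum, ← hR]
    congr 1
    exact Finset.sum_congr rfl fun _ _ => Finset.sum_congr rfl fun _ _ => by ring
  simp only [h4, Finset.sum_neg_distrib, neg_neg, ricci, Finset.sum_mul]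
  exact (Finset.sum_congr rfl fun _ _ => Finset.sum_comm).trans Finset.sum_comm

end Components
section Frame

variable {F : Type*} [NormedAddCommGroup F] [NormedSpace ℝ F] {n : ℕ}
  {B : F →L[ℝ] F →L[ℝ] ℝ} {e : Fin n → F} {N : F} {ϵ : ℝ} {H : Matrix (Fin n) (Fin n) ℝ}

theorem eq_sum_tangent_add_normal (hF : Module.finrank ℝ F = n + 1)
    (hB : ∀ u v, B u v = B v u) (horth : ∀ a, B N (e a) = 0) (hunit : B N N = ϵ)
    (hϵ : ϵ * ϵ = 1) (hH : H * Matrix.of (fun a b => B (e a) (e b)) = 1) (v : F) :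
    v = ∑ a, (∑ b, H a b * B (e b) v) • e a + (ϵ * B N v) • N := by
  have hcoef : ∀ (c : Fin n → ℝ) (d : ℝ) (a : Fin n),
      ∑ b, H a b * B (e b) (∑ a, c a • e a + d • N) = c a := by
    intro c d a
    have h1 : ∀ b, B (e b) (∑ a, c a • e a + d • N) = ∑ a, B (e b) (e a) * c a := by
      intro b
      simp [hB (e b) N, horth, mul_comm]
    have h2 : ∀ i, ∑ b, H a b * B (e b) (e i) = (1 : Matrix (Fin n) (Fin n) ℝ) a i := by
      intro i
      rw [← hH, Matrix.mul_apply]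
      rfl
    simp only [h1, Finset.mul_sum]
    rw [Finset.sum_comm]
    simp only [← mul_assoc, ← Finset.sum_mul, h2]
    simp [Matrix.one_apply]
  have hcoefN : ∀ (c : Fin n → ℝ) (d : ℝ), ϵ * B N (∑ a, c a • e a + d • N) = d := by
    intro c d
    simp only [map_add, map_sum, map_smul, horth, hunit, smul_eq_mul, mul_zero,
      Finset.sum_const_zero, zero_add]
    linear_combination d * hϵ
  have hli : LinearIndependent ℝ (fun o : Option (Fin n) => o.elim N e) := by
    rw [Fintype.linearIndependent_iff]
    intro c hc
    rw [Fintype.sum_option, add_comm] at hc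
    have h1 := fun a => hcoef (fun a => c (some a)) (c none) a
    have h2 := hcoefN (fun a => c (some a)) (c none)
    simp only [Option.elim] at hc
    simp only [hc, map_zero, mul_zero, Finset.sum_const_zero] at h1 h2
    rintro (_ | a)
    · exact h2.symm
    · exact (h1 a).symm
  have hspan := hli.span_eq_top_of_card_eq_finrank (by simp [hF])
  obtain ⟨c, rfl⟩ := (Submodule.mem_span_range_iff_exists_fun ℝ).1
    (hspan ▸ Submodule.mem_top : v ∈ Submodule.span ℝ _)
  rw [Fintype.sum_option, add_comm]
  simp only [Option.elim, hcoef, hcoefN]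

theorem sum_apply_single_eq {n : ℕ} {B : (Fin (n + 1) → ℝ) →L[ℝ] (Fin (n + 1) → ℝ) →L[ℝ] ℝ}
    {e : Fin n → Fin (n + 1) → ℝ} {N : Fin (n + 1) → ℝ} {ϵ : ℝ} {H : Matrix (Fin n) (Fin n) ℝ}
    (hB : ∀ u v, B u v = B v u) (horth : ∀ a, B N (e a) = 0) (hunit : B N N = ϵ)
    (hϵ : ϵ * ϵ = 1) (hH : H * Matrix.of (fun a b => B (e a) (e b)) = 1)
    (L : (Fin (n + 1) → ℝ) →ₗ[ℝ] (Fin (n + 1) → ℝ)) :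
    ∑ l, L (Pi.single l 1) l = ∑ a, ∑ b, H a b * B (e b) (L (e a)) + ϵ * B N (L N) := by
  have hdec := eq_sum_tangent_add_normal (by simp) hB horth hunit hϵ hH
  have hpair : ∀ w z, ∑ l, B w (Pi.single l 1) * z l = B w z := by
    intro w z
    conv_rhs => rw [pi_eq_sum_univ' z]
    simp [mul_comm]
  have h1 : ∀ l, L (Pi.single l 1) l
      = ∑ a, ∑ b, H a b * (B (e b) (Pi.single l 1) * L (e a) l)
        + ϵ * (B N (Pi.single l 1) * L N l) := by
    intro l
    conv_lhs => rw [hdec (Pi.single l 1)]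
    simp [Finset.sum_mul, mul_assoc]
  simp only [h1, Finset.sum_add_distrib, ← Finset.mul_sum, hpair]
  congr 1
  rw [Finset.sum_comm]
  refine Finset.sum_congr rfl fun a _ => ?_
  rw [Finset.sum_comm]
  simp only [← Finset.mul_sum, hpair]

theorem left_inv_symm {ι : Type*} [Fintype ι] [DecidableEq ι] {H h : Matrix ι ι ℝ}
    (hH : H * h = 1) (hh : ∀ a b, h a b = h b a) (a b : ι) : H a b = H b a := by
  have ht : h.transpose = h := Matrix.ext fun i j => hh j i
  rw [← Matrix.inv_eq_left_inv hH]
  conv_lhs => rw [← ht, ← Matrix.transpose_nonsing_inv, Matrix.transpose_apply]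

theorem trace_mul_mul_mul {ι : Type*} [Fintype ι] (A B C D : Matrix ι ι ℝ) :
    (A * B * C * D).trace = ∑ a, ∑ b, ∑ c, ∑ d, A a b * B b c * C c d * D d a := by
  simp only [Matrix.trace, Matrix.diag, Matrix.mul_apply, Finset.sum_mul]
  refine Finset.sum_congr rfl fun a _ => ?_
  rw [Finset.sum_comm]
  conv_rhs => rw [Finset.sum_comm]
  exact Finset.sum_congr rfl fun c _ => Finset.sum_comm

open scoped Matrix in
theorem trace_variation {ι : Type*} [Fintype ι] [DecidableEq ι] {H h K H' h' K' B S : Matrix ι ι ℝ}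
    {f : ℝ} (hH : H * h = 1) (hder : H' * h + H * h' = 0)
    (hh' : h' = (2 * f) • K + B * h + h * Bᵀ)
    (hK' : K' = f • (K * H * K) + B * K + K * Bᵀ + S) :
    (H' * K).trace + (H * K').trace = -f * (H * K * H * K).trace + (H * S).trace := by
  have hh : h * H = 1 := mul_eq_one_comm.mp hH
  have hH' : H' = -(H * h' * H) := by
    have := congrArg (· * H) hder
    simp only [add_mul, mul_assoc, hh, zero_mul, mul_one] at this
    rw [mul_assoc]
    exact eq_neg_of_add_eq_zero_left this
  have e1 : H * h' * H = (2 * f) • (H * K * H) + H * B + Bᵀ * H := by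
    rw [hh']
    simp only [mul_add, add_mul, Matrix.mul_smul, Matrix.smul_mul]
    rw [show H * (B * h) * H = H * B * (h * H) by noncomm_ring,
      show H * (h * Bᵀ) * H = H * h * Bᵀ * H by noncomm_ring, hh, hH]
    simp
  have e2 : (Bᵀ * H * K).trace = (H * K * Bᵀ).trace := by
    rw [mul_assoc, Matrix.trace_mul_comm]
  rw [hH', e1, hK']
  simp only [neg_mul, Matrix.trace_neg, add_mul, mul_add, Matrix.trace_add, Matrix.smul_mul,
    Matrix.mul_smul, Matrix.trace_smul, smul_eq_mul, e2, ← mul_assoc]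
  ring

end Frame
section Family

variable {Y F : Type*} [NormedAddCommGroup Y] [NormedSpace ℝ Y]
  [NormedAddCommGroup F] [NormedSpace ℝ F]

theorem fderiv_slice {K : Type*} [NormedAddCommGroup K] [NormedSpace ℝ K] {A : ℝ × Y → K}
    {q : ℝ × Y} (hA : DifferentiableAt ℝ A q) (v : Y) :
    fderiv ℝ (fun z => A (q.1, z)) q.2 v = fderiv ℝ A q (0, v) := by
  have h : HasFDerivAt (fun z => A (q.1, z)) _ q.2 :=
    HasFDerivAt.comp (g := A) q.2 hA.hasFDerivAt (hasFDerivAt_prodMk_right q.1 q.2)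
  rw [h.fderiv]
  simp

theorem fderiv_eq_of_eqOn_slice {K : Type*} [NormedAddCommGroup K] [NormedSpace ℝ K]
    {A B : ℝ × Y → K} {Ω : Set (ℝ × Y)} (hΩ : IsOpen Ω) {q : ℝ × Y} (hq : q ∈ Ω)
    (hA : DifferentiableAt ℝ A q) (hB : DifferentiableAt ℝ B q)
    (hAB : ∀ p ∈ Ω, p.1 = q.1 → A p = B p) {v : ℝ × Y} (hv : v.1 = 0) :
    fderiv ℝ A q v = fderiv ℝ B q v := by
  obtain ⟨_, v⟩ := v
  obtain rfl := hv
  rw [← fderiv_slice hA, ← fderiv_slice hB, Filter.EventuallyEq.fderiv_eq]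
  have hc : Continuous fun z : Y => (q.1, z) := by fun_prop
  filter_upwards [(hΩ.preimage hc).mem_nhds hq] with z hz using hAB _ hz rfl

/-- A family of hypersurface immersions `Φ`, parametrized on the open set `Ω`, with unit normals `N`
and coordinate directions `e`, in an ambient space with metric `G` and Christoffel symbols `Γ`. -/
structure IsHypersurfaceFamily {ι : Type*} (G : F → F →L[ℝ] F →L[ℝ] ℝ)
    (Γ : F → F →L[ℝ] F →L[ℝ] F) (Φ N : ℝ × Y → F) (e : ι → ℝ × Y) (ϵ : ℝ)
    (Ω : Set (ℝ × Y)) : Prop where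
  isOpen : IsOpen Ω
  contDiffAt_map : ∀ q ∈ Ω, ContDiffAt ℝ 2 Φ q
  contDiffAt_normal : ∀ q ∈ Ω, ContDiffAt ℝ 2 N q
  differentiableAt_metric : ∀ q ∈ Ω, DifferentiableAt ℝ G (Φ q)
  differentiableAt_christoffel : ∀ q ∈ Ω, DifferentiableAt ℝ Γ (Φ q)
  metric_symm : ∀ q ∈ Ω, ∀ u v, G (Φ q) u v = G (Φ q) v u
  christoffel_symm : ∀ q ∈ Ω, ∀ u v, Γ (Φ q) u v = Γ (Φ q) v u
  compat : ∀ q ∈ Ω, ∀ u v w, fderiv ℝ G (Φ q) u v w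
    = G (Φ q) (Γ (Φ q) u v) w + G (Φ q) v (Γ (Φ q) u w)
  orth : ∀ q ∈ Ω, ∀ a, G (Φ q) (N q) (fderiv ℝ Φ q (e a)) = 0
  unit : ∀ q ∈ Ω, G (Φ q) (N q) (N q) = ϵ
  spatial : ∀ a, (e a).1 = 0

namespace IsHypersurfaceFamily

variable {ι : Type*} {G : F → F →L[ℝ] F →L[ℝ] ℝ} {Γ : F → F →L[ℝ] F →L[ℝ] F}
  {Φ N : ℝ × Y → F} {e : ι → ℝ × Y} {ϵ : ℝ} {Ω : Set (ℝ × Y)} {q : ℝ × Y}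

theorem differentiableAt_map (S : IsHypersurfaceFamily G Γ Φ N e ϵ Ω) (hq : q ∈ Ω) :
    DifferentiableAt ℝ Φ q :=
  (S.contDiffAt_map q hq).differentiableAt (by norm_num)

theorem differentiableAt_normal (S : IsHypersurfaceFamily G Γ Φ N e ϵ Ω) (hq : q ∈ Ω) :
    DifferentiableAt ℝ N q :=
  (S.contDiffAt_normal q hq).differentiableAt (by norm_num)

theorem differentiableAt_fderiv_map (S : IsHypersurfaceFamily G Γ Φ N e ϵ Ω) (hq : q ∈ Ω)
    (u : ℝ × Y) : DifferentiableAt ℝ (fun p => fderiv ℝ Φ p u) q :=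
  (contDiffAt_fderiv_apply (m := 1) (S.contDiffAt_map q hq) (by norm_num) u).differentiableAt
    (by norm_num)

theorem differentiableAt_covDeriv_normal (S : IsHypersurfaceFamily G Γ Φ N e ϵ Ω) (hq : q ∈ Ω)
    (u : ℝ × Y) : DifferentiableAt ℝ (covDeriv Γ Φ N u) q :=
  covDeriv_differentiableAt (S.differentiableAt_christoffel q hq) (S.contDiffAt_map q hq)
    (S.contDiffAt_normal q hq) u

theorem differentiableAt_inner (S : IsHypersurfaceFamily G Γ Φ N e ϵ Ω) (hq : q ∈ Ω)
    {w z : ℝ × Y → F} (hw : DifferentiableAt ℝ w q) (hz : DifferentiableAt ℝ z q) :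
    DifferentiableAt ℝ (fun p => G (Φ p) (w p) (z p)) q :=
  (fderiv_bilin_comp (S.differentiableAt_metric q hq) (S.differentiableAt_map hq)
    hw hz).1.differentiableAt

theorem fderiv_inner (S : IsHypersurfaceFamily G Γ Φ N e ϵ Ω) (hq : q ∈ Ω)
    {w z : ℝ × Y → F} (hw : DifferentiableAt ℝ w q) (hz : DifferentiableAt ℝ z q) (u : ℝ × Y) :
    fderiv ℝ (fun p => G (Φ p) (w p) (z p)) q u
      = G (Φ q) (covDeriv Γ Φ w u q) (z q) + G (Φ q) (w q) (covDeriv Γ Φ z u q) :=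
  fderiv_metric_comp (S.differentiableAt_metric q hq) (S.differentiableAt_map hq) hw hz
    (S.compat q hq) u

theorem covDeriv_comm (S : IsHypersurfaceFamily G Γ Φ N e ϵ Ω) (hq : q ∈ Ω) (u v : ℝ × Y) :
    covDeriv Γ Φ (fun p => fderiv ℝ Φ p v) u q = covDeriv Γ Φ (fun p => fderiv ℝ Φ p u) v q :=
  covDeriv_fderiv_comm (S.contDiffAt_map q hq) (S.christoffel_symm q hq) u v

theorem inner_normal_covDeriv_normal (S : IsHypersurfaceFamily G Γ Φ N e ϵ Ω) (hq : q ∈ Ω)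
    (u : ℝ × Y) : G (Φ q) (N q) (covDeriv Γ Φ N u q) = 0 := by
  have h := S.fderiv_inner hq (S.differentiableAt_normal hq) (S.differentiableAt_normal hq) u
  rw [Filter.EventuallyEq.fderiv_eq (f := fun _ => ϵ)
    (by filter_upwards [S.isOpen.mem_nhds hq] with p hp using S.unit p hp),
    S.metric_symm q hq (covDeriv Γ Φ N u q)] at h
  simp at h
  linarith

theorem inner_tangent_covDeriv_normal (S : IsHypersurfaceFamily G Γ Φ N e ϵ Ω) (hq : q ∈ Ω)
    (u : ℝ × Y) (a : ι) : G (Φ q) (fderiv ℝ Φ q (e a)) (covDeriv Γ Φ N u q)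
      = -G (Φ q) (N q) (covDeriv Γ Φ (fun p => fderiv ℝ Φ p (e a)) u q) := by
  have h := S.fderiv_inner hq (S.differentiableAt_normal hq)
    (S.differentiableAt_fderiv_map hq (e a)) u
  rw [Filter.EventuallyEq.fderiv_eq (f := fun _ => 0)
    (by filter_upwards [S.isOpen.mem_nhds hq] with p hp using S.orth p hp a),
    S.metric_symm q hq (covDeriv Γ Φ N u q)] at h
  simp at h
  linarith

/-- The extrinsic curvature is symmetric. -/
theorem extrinsic_symm (S : IsHypersurfaceFamily G Γ Φ N e ϵ Ω) (hq : q ∈ Ω) (a b : ι) :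
    G (Φ q) (fderiv ℝ Φ q (e a)) (covDeriv Γ Φ N (e b) q)
      = G (Φ q) (fderiv ℝ Φ q (e b)) (covDeriv Γ Φ N (e a) q) := by
  rw [S.inner_tangent_covDeriv_normal hq, S.inner_tangent_covDeriv_normal hq,
    S.covDeriv_comm hq]

/-- The Koszul formula for the Christoffel symbols of the first kind of the induced metric. -/
theorem koszul (S : IsHypersurfaceFamily G Γ Φ N e ϵ Ω) (hq : q ∈ Ω) (a b d : ι) :
    (1 / 2) * (fderiv ℝ (fun p => G (Φ p) (fderiv ℝ Φ p (e d)) (fderiv ℝ Φ p (e b))) q (e a)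
      + fderiv ℝ (fun p => G (Φ p) (fderiv ℝ Φ p (e d)) (fderiv ℝ Φ p (e a))) q (e b)
      - fderiv ℝ (fun p => G (Φ p) (fderiv ℝ Φ p (e a)) (fderiv ℝ Φ p (e b))) q (e d))
      = G (Φ q) (fderiv ℝ Φ q (e d))
        (covDeriv Γ Φ (fun p => fderiv ℝ Φ p (e b)) (e a) q) := by
  have hE := fun c => S.differentiableAt_fderiv_map hq (e c)
  rw [S.fderiv_inner hq (hE d) (hE b), S.fderiv_inner hq (hE d) (hE a),
    S.fderiv_inner hq (hE a) (hE b), S.covDeriv_comm hq (e a) (e d), S.covDeriv_comm hq (e b) (e d),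
    S.covDeriv_comm hq (e b) (e a), S.metric_symm q hq _ (fderiv ℝ Φ q (e a))]
  ring

variable [Fintype ι] {T : ℝ × Y} {f : ℝ × Y → ℝ} {X : ι → ℝ × Y → ℝ}

/-- Spatial derivative of a variation field `f N + Σ X^b ∂_bΦ`. -/
theorem covDeriv_variation (S : IsHypersurfaceFamily G Γ Φ N e ϵ Ω) (hq : q ∈ Ω)
    (hf : DifferentiableAt ℝ f q) (hX : ∀ b, DifferentiableAt ℝ (X b) q)
    (hdec : ∀ p ∈ Ω, p.1 = q.1 →
      fderiv ℝ Φ p T = f p • N p + ∑ b, X b p • fderiv ℝ Φ p (e b)) (a : ι) :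
    covDeriv Γ Φ (fun p => fderiv ℝ Φ p (e a)) T q
      = (fderiv ℝ f q (e a) • N q + f q • covDeriv Γ Φ N (e a) q)
        + ∑ b, (fderiv ℝ (X b) q (e a) • fderiv ℝ Φ q (e b)
          + X b q • covDeriv Γ Φ (fun p => fderiv ℝ Φ p (e b)) (e a) q) := by
  have hN := S.differentiableAt_normal hq
  have hE := fun b => S.differentiableAt_fderiv_map hq (e b)
  have hXE : ∀ b, DifferentiableAt ℝ (fun p => X b p • fderiv ℝ Φ p (e b)) q :=
    fun b => (hX b).smul (hE b)
  have hsum : DifferentiableAt ℝ (fun p => ∑ b, X b p • fderiv ℝ Φ p (e b)) q :=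
    DifferentiableAt.fun_sum fun b _ => hXE b
  have hfN : DifferentiableAt ℝ (fun p => f p • N p) q := hf.smul hN
  have h1 : covDeriv Γ Φ (fun p => fderiv ℝ Φ p T) (e a) q
      = covDeriv Γ Φ (fun p => f p • N p + ∑ b, X b p • fderiv ℝ Φ p (e b)) (e a) q := by
    unfold covDeriv
    rw [fderiv_eq_of_eqOn_slice S.isOpen hq (S.differentiableAt_fderiv_map hq T)
      (hfN.fun_add hsum) hdec (S.spatial a)]
    simp only [hdec q hq rfl]
  rw [S.covDeriv_comm hq, h1, covDeriv_add hfN hsum, covDeriv_smul hf hN, covDeriv_sum hXE]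
  simp only [covDeriv_smul (hX _) (hE _)]

theorem inner_tangent_covDeriv_normal_variation (S : IsHypersurfaceFamily G Γ Φ N e ϵ Ω)
    (hq : q ∈ Ω) (hf : DifferentiableAt ℝ f q) (hX : ∀ b, DifferentiableAt ℝ (X b) q)
    (hdec : ∀ p ∈ Ω, p.1 = q.1 →
      fderiv ℝ Φ p T = f p • N p + ∑ b, X b p • fderiv ℝ Φ p (e b)) (a : ι) :
    G (Φ q) (fderiv ℝ Φ q (e a)) (covDeriv Γ Φ N T q)
      = -ϵ * fderiv ℝ f q (e a)
        + ∑ c, X c q * G (Φ q) (fderiv ℝ Φ q (e c)) (covDeriv Γ Φ N (e a) q) := by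
  rw [S.inner_tangent_covDeriv_normal hq, S.covDeriv_variation hq hf hX hdec]
  simp only [map_add, map_sum, map_smul, smul_eq_mul, S.unit q hq, S.orth q hq,
    S.inner_normal_covDeriv_normal hq, S.inner_tangent_covDeriv_normal hq, mul_neg,
    Finset.sum_neg_distrib, mul_zero, zero_add, add_zero]
  ring

theorem fderiv_indMet (S : IsHypersurfaceFamily G Γ Φ N e ϵ Ω)
    (hq : q ∈ Ω) (hf : DifferentiableAt ℝ f q) (hX : ∀ b, DifferentiableAt ℝ (X b) q)
    (hdec : ∀ p ∈ Ω, p.1 = q.1 →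
      fderiv ℝ Φ p T = f p • N p + ∑ b, X b p • fderiv ℝ Φ p (e b))
    (hX0 : ∀ b, X b q = 0) (a b : ι) :
    fderiv ℝ (fun p => G (Φ p) (fderiv ℝ Φ p (e a)) (fderiv ℝ Φ p (e b))) q T
      = 2 * f q * G (Φ q) (fderiv ℝ Φ q (e a)) (covDeriv Γ Φ N (e b) q)
        + ∑ c, fderiv ℝ (X c) q (e a) * G (Φ q) (fderiv ℝ Φ q (e c)) (fderiv ℝ Φ q (e b))
        + ∑ c, G (Φ q) (fderiv ℝ Φ q (e a)) (fderiv ℝ Φ q (e c)) * fderiv ℝ (X c) q (e b) := by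
  rw [S.fderiv_inner hq (S.differentiableAt_fderiv_map hq _) (S.differentiableAt_fderiv_map hq _),
    S.metric_symm q hq (covDeriv Γ Φ _ T q), S.covDeriv_variation hq hf hX hdec,
    S.covDeriv_variation hq hf hX hdec]
  simp only [hX0, zero_smul, add_zero, map_add, map_sum, map_smul, smul_eq_mul,
    S.metric_symm q hq _ (N q), S.orth q hq, mul_zero, zero_add]
  rw [S.extrinsic_symm hq b a]
  simp only [S.metric_symm q hq (fderiv ℝ Φ q (e b)), mul_comm (fderiv ℝ (X _) q (e b))]
  ring

variable {n : ℕ} {e : Fin n → ℝ × Y} {X : Fin n → ℝ × Y → ℝ} {H : Matrix (Fin n) (Fin n) ℝ}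

theorem inner_eq_of_orth_normal (S : IsHypersurfaceFamily G Γ Φ N e ϵ Ω)
    (hF : Module.finrank ℝ F = n + 1) (hϵ : ϵ * ϵ = 1) (hq : q ∈ Ω)
    (hH : H * Matrix.of (fun a b => G (Φ q) (fderiv ℝ Φ q (e a)) (fderiv ℝ Φ q (e b))) = 1)
    {v : F} (hv : G (Φ q) (N q) v = 0) (w : F) :
    G (Φ q) w v = ∑ c, ∑ d, G (Φ q) w (fderiv ℝ Φ q (e c)) * H c d
      * G (Φ q) (fderiv ℝ Φ q (e d)) v := by
  have h := eq_sum_tangent_add_normal hF (S.metric_symm q hq) (S.orth q hq) (S.unit q hq) hϵ hH v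
  conv_lhs => rw [h, hv]
  simp only [mul_zero, zero_smul, add_zero, map_sum, map_smul, smul_eq_mul, Finset.sum_mul]
  exact Finset.sum_congr rfl fun _ _ => Finset.sum_congr rfl fun _ _ => by ring

theorem fderiv_extrinsic (S : IsHypersurfaceFamily G Γ Φ N e ϵ Ω)
    (hF : Module.finrank ℝ F = n + 1) (hϵ : ϵ * ϵ = 1) (hq : q ∈ Ω)
    (hH : H * Matrix.of (fun a b => G (Φ q) (fderiv ℝ Φ q (e a)) (fderiv ℝ Φ q (e b))) = 1)
    (hf : ∀ p ∈ Ω, ContDiffAt ℝ 2 f p) (hX : ∀ p ∈ Ω, ∀ b, DifferentiableAt ℝ (X b) p)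
    (hdec : ∀ p ∈ Ω, p.1 = q.1 →
      fderiv ℝ Φ p T = f p • N p + ∑ b, X b p • fderiv ℝ Φ p (e b))
    (hX0 : ∀ b, X b q = 0) (a b : Fin n) :
    fderiv ℝ (fun p => G (Φ p) (fderiv ℝ Φ p (e a)) (covDeriv Γ Φ N (e b) p)) q T
      = f q * (∑ c, ∑ d, G (Φ q) (fderiv ℝ Φ q (e a)) (covDeriv Γ Φ N (e c) q) * H c d
          * G (Φ q) (fderiv ℝ Φ q (e d)) (covDeriv Γ Φ N (e b) q))
        + ∑ c, fderiv ℝ (X c) q (e a) * G (Φ q) (fderiv ℝ Φ q (e c)) (covDeriv Γ Φ N (e b) q)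
        + ∑ c, G (Φ q) (fderiv ℝ Φ q (e a)) (covDeriv Γ Φ N (e c) q) * fderiv ℝ (X c) q (e b)
        + (f q * G (Φ q) (fderiv ℝ Φ q (e a))
            (curvOp Γ (Φ q) (N q) (fderiv ℝ Φ q (e b)) (N q))
          - ϵ * (fderiv ℝ (fun p => fderiv ℝ f p (e a)) q (e b)
            - ∑ c, (∑ d, H c d * G (Φ q) (fderiv ℝ Φ q (e d))
                (covDeriv Γ Φ (fun p => fderiv ℝ Φ p (e a)) (e b) q)) * fderiv ℝ f q (e c))) := by
  have hfd : ∀ p ∈ Ω, DifferentiableAt ℝ f p := fun p hp =>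
    (hf p hp).differentiableAt (by norm_num)
  have hdT : fderiv ℝ Φ q T = f q • N q := by simpa [hX0] using hdec q hq rfl
  have hE := fun c => S.differentiableAt_fderiv_map hq (e c)
  have hDN := fun u => S.differentiableAt_covDeriv_normal hq u
  have hff : DifferentiableAt ℝ (fun p => fderiv ℝ f p (e a)) q :=
    (contDiffAt_fderiv_apply (m := 1) (hf q hq) (by norm_num) _).differentiableAt (by norm_num)
  have hKd : ∀ c, DifferentiableAt ℝ (fun p => X c p
      * G (Φ p) (fderiv ℝ Φ p (e c)) (covDeriv Γ Φ N (e a) p)) q := fun c =>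
    (hX q hq c).mul (S.differentiableAt_inner hq (hE c) (hDN (e a)))
  have hnT : ∀ c, G (Φ q) (fderiv ℝ Φ q (e c)) (covDeriv Γ Φ N T q)
      = -ϵ * fderiv ℝ f q (e c) := fun c => by
    rw [S.inner_tangent_covDeriv_normal_variation hq (hfd q hq) (hX q hq) hdec]
    simp [hX0]
  have h1 : fderiv ℝ (fun p => G (Φ p) (fderiv ℝ Φ p (e a)) (covDeriv Γ Φ N T p)) q (e b)
      = -ϵ * fderiv ℝ (fun p => fderiv ℝ f p (e a)) q (e b)
        + ∑ c, fderiv ℝ (X c) q (e b)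
          * G (Φ q) (fderiv ℝ Φ q (e c)) (covDeriv Γ Φ N (e a) q) := by
    have hsum : DifferentiableAt ℝ (fun p => ∑ c, X c p
      * G (Φ p) (fderiv ℝ Φ p (e c)) (covDeriv Γ Φ N (e a) p)) q :=
      DifferentiableAt.fun_sum fun c _ => hKd c
    rw [fderiv_eq_of_eqOn_slice S.isOpen hq (S.differentiableAt_inner hq (hE a) (hDN T))
      ((hff.const_mul (-ϵ)).fun_add hsum)
      (fun p hp hpq => S.inner_tangent_covDeriv_normal_variation hp (hfd p hp) (hX p hp)
        (fun p' hp' h => hdec p' hp' (h.trans hpq)) a) (S.spatial b),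
      fderiv_fun_add (hff.const_mul (-ϵ)) hsum, add_apply, fderiv_const_mul hff,
      fderiv_fun_sum fun c _ => hKd c]
    simp only [sum_apply, smul_apply, smul_eq_mul]
    congr 1
    refine Finset.sum_congr rfl fun c _ => ?_
    rw [fderiv_fun_mul (hX q hq c) (S.differentiableAt_inner hq (hE c) (hDN (e a)))]
    simp [hX0, mul_comm]
  rw [S.fderiv_inner hq (hE a) (hDN T)] at h1
  have h2 : G (Φ q) (covDeriv Γ Φ (fun p => fderiv ℝ Φ p (e a)) (e b) q) (covDeriv Γ Φ N T q)
      = -ϵ * ∑ c, (∑ d, H c d * G (Φ q) (fderiv ℝ Φ q (e d))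
                (covDeriv Γ Φ (fun p => fderiv ℝ Φ p (e a)) (e b) q)) * fderiv ℝ f q (e c) := by
    have hHt : ∀ c d, H c d = H d c := fun c d =>
      left_inv_symm hH (fun _ _ => S.metric_symm q hq _ _) c d
    rw [S.inner_eq_of_orth_normal hF hϵ hq hH (S.inner_normal_covDeriv_normal hq T)]
    simp only [hnT, Finset.mul_sum, Finset.sum_mul]
    rw [Finset.sum_comm]
    refine Finset.sum_congr rfl fun c _ => Finset.sum_congr rfl fun d _ => ?_
    rw [S.metric_symm q hq _ (fderiv ℝ Φ q (e d)), hHt c d]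
    ring
  have h3 : covDeriv Γ Φ (covDeriv Γ Φ N (e b)) T q = covDeriv Γ Φ (covDeriv Γ Φ N T) (e b) q
      + f q • curvOp Γ (Φ q) (N q) (fderiv ℝ Φ q (e b)) (N q) := by
    rw [← sub_eq_iff_eq_add', covDeriv_covDeriv_sub (S.differentiableAt_christoffel q hq)
      (S.contDiffAt_map q hq) (S.contDiffAt_normal q hq), hdT]
    simp [curvOp, smul_sub]
  rw [S.fderiv_inner hq (hE a) (hDN (e b)), h3,
    S.covDeriv_variation hq (hfd q hq) (hX q hq) hdec]
  simp only [hX0, zero_smul, add_zero, map_add, map_sum, map_smul, smul_eq_mul, add_apply,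
    sum_apply, smul_apply, S.inner_normal_covDeriv_normal hq, mul_zero, zero_add]
  rw [S.inner_eq_of_orth_normal hF hϵ hq hH (S.inner_normal_covDeriv_normal hq (e b))
    (covDeriv Γ Φ N (e a) q)]
  simp only [S.metric_symm q hq (covDeriv Γ Φ N (e a) q), S.extrinsic_symm hq _ a] at h1 h2 ⊢
  simp only [mul_comm (G (Φ q) (fderiv ℝ Φ q (e a)) _) (fderiv ℝ (X _) q (e b))]
  linarith

end IsHypersurfaceFamily

end Family
section Coordinates

variable {n : ℕ}

/-- The `a`-th spatial coordinate direction in the parameter space `ℝ × ℝⁿ`. -/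
def coordDir (a : Fin n) : ℝ × (Fin n → ℝ) := (0, Pi.single a 1)

theorem pder_slice_eq {A : ℝ → (Fin n → ℝ) → ℝ} {B : ℝ × (Fin n → ℝ) → ℝ}
    {Ω : Set (ℝ × (Fin n → ℝ))} (hΩ : IsOpen Ω) {q : ℝ × (Fin n → ℝ)} (hq : q ∈ Ω)
    (hB : DifferentiableAt ℝ B q) (hAB : ∀ p ∈ Ω, A p.1 p.2 = B p) (a : Fin n) :
    pder (fun z => A q.1 z) a q.2 = fderiv ℝ B q (coordDir a) := by
  rw [coordDir, ← fderiv_slice hB, pder, Filter.EventuallyEq.fderiv_eq]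
  have hc : Continuous fun z : Fin n → ℝ => (q.1, z) := by fun_prop
  filter_upwards [(hΩ.preimage hc).mem_nhds hq] with z hz using hAB _ hz

theorem deriv_slice_eq {A : ℝ → (Fin n → ℝ) → ℝ} {B : ℝ × (Fin n → ℝ) → ℝ}
    {Ω : Set (ℝ × (Fin n → ℝ))} (hΩ : IsOpen Ω) {q : ℝ × (Fin n → ℝ)} (hq : q ∈ Ω)
    (hB : DifferentiableAt ℝ B q) (hAB : ∀ p ∈ Ω, A p.1 p.2 = B p) :
    deriv (fun t => A t q.2) q.1 = fderiv ℝ B q (1, 0) := by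
  have hc : Continuous fun t : ℝ => (t, q.2) := by fun_prop
  have h : HasFDerivAt (fun t => B (t, q.2)) _ q.1 :=
    HasFDerivAt.comp (g := B) q.1 hB.hasFDerivAt (hasFDerivAt_prodMk_left q.1 q.2)
  rw [Filter.EventuallyEq.deriv_eq (f := fun t => B (t, q.2))
    (by filter_upwards [(hΩ.preimage hc).mem_nhds hq] with t ht using hAB _ ht),
    h.hasDerivAt.deriv]
  simp

theorem fderiv_apply_eq {E : Type*} [NormedAddCommGroup E] [NormedSpace ℝ E] {N : ℕ}
    {A : E → Fin N → ℝ} {q : E} (hA : DifferentiableAt ℝ A q) (u : E) (μ : Fin N) :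
    fderiv ℝ (fun p => A p μ) q u = fderiv ℝ A q u μ := by
  rw [(hasFDerivAt_pi'.1 hA.hasFDerivAt μ).fderiv]
  rfl

theorem pder_slice_apply {A : ℝ → (Fin n → ℝ) → Fin (n + 1) → ℝ} {q : ℝ × (Fin n → ℝ)}
    (hA : DifferentiableAt ℝ (fun q : ℝ × (Fin n → ℝ) => A q.1 q.2) q) (a : Fin n)
    (μ : Fin (n + 1)) :
    pder (fun z => A q.1 z μ) a q.2
      = fderiv ℝ (fun q : ℝ × (Fin n → ℝ) => A q.1 q.2) q (coordDir a) μ := by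
  rw [← fderiv_apply_eq hA]
  exact pder_slice_eq (A := fun t z => A t z μ) isOpen_univ (Set.mem_univ q)
    (differentiableAt_pi.1 hA μ) (fun _ _ => rfl) a

theorem Dphi_eq_fderiv {φ : ℝ → (Fin n → ℝ) → Fin (n + 1) → ℝ} {q : ℝ × (Fin n → ℝ)}
    (hφ : DifferentiableAt ℝ (fun q : ℝ × (Fin n → ℝ) => φ q.1 q.2) q) (a : Fin n)
    (μ : Fin (n + 1)) :
    Dphi φ q.1 q.2 a μ = fderiv ℝ (fun q : ℝ × (Fin n → ℝ) => φ q.1 q.2) q (coordDir a) μ :=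
  pder_slice_apply hφ a μ

variable {g : (Fin (n + 1) → ℝ) → Fin (n + 1) → Fin (n + 1) → ℝ} {V : Set (Fin (n + 1) → ℝ)}
  {φ nrm : ℝ → (Fin n → ℝ) → Fin (n + 1) → ℝ} {q : ℝ × (Fin n → ℝ)}

theorem extK_eq (hV : IsOpen V) (hgsym : ∀ x ∈ V, ∀ μ ν, g x μ ν = g x ν μ)
    (hq : φ q.1 q.2 ∈ V) (hφ : DifferentiableAt ℝ (fun q : ℝ × (Fin n → ℝ) => φ q.1 q.2) q)
    (hnrm : DifferentiableAt ℝ (fun q : ℝ × (Fin n → ℝ) => nrm q.1 q.2) q) (a b : Fin n) :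
    extK g φ nrm q.1 q.2 a b = formOf (g (φ q.1 q.2))
      (fderiv ℝ (fun q : ℝ × (Fin n → ℝ) => φ q.1 q.2) q (coordDir a))
      (covDeriv (fun z => bilinOf (christoffel g z)) (fun q : ℝ × (Fin n → ℝ) => φ q.1 q.2)
        (fun q : ℝ × (Fin n → ℝ) => nrm q.1 q.2) (coordDir b) q) := by
  simp only [extK, formOf_apply, covDeriv, Pi.add_apply, bilinOf_apply, Dphi_eq_fderiv hφ,
    pder_slice_apply hnrm]
  refine Finset.sum_congr rfl fun μ _ => Finset.sum_congr rfl fun ν _ => ?_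
  congr 2
  rw [Finset.sum_comm]
  refine Finset.sum_congr rfl fun σ _ => Finset.sum_congr rfl fun l _ => ?_
  rw [christoffel_symm hV hgsym hq]
  ring

theorem isHypersurfaceFamily_coord {Ω : Set (ℝ × (Fin n → ℝ))} {ϵ : ℝ} (hV : IsOpen V)
    (hg : ∀ x ∈ V, ∀ μ ν, ContDiffAt ℝ 2 (fun z => g z μ ν) x)
    (hgsym : ∀ x ∈ V, ∀ μ ν, g x μ ν = g x ν μ)
    (hgunit : ∀ x ∈ V, IsUnit (Matrix.of (g x)).det) (hΩ : IsOpen Ω)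
    (hφ : ∀ q ∈ Ω, ∀ μ, ContDiffAt ℝ 2 (fun q : ℝ × (Fin n → ℝ) => φ q.1 q.2 μ) q)
    (hφV : ∀ q ∈ Ω, φ q.1 q.2 ∈ V)
    (hnrm : ∀ q ∈ Ω, ∀ μ, ContDiffAt ℝ 2 (fun q : ℝ × (Fin n → ℝ) => nrm q.1 q.2 μ) q)
    (horth : ∀ q ∈ Ω, ∀ a : Fin n, (∑ μ, ∑ ν, g (φ q.1 q.2) μ ν * nrm q.1 q.2 μ
      * Dphi φ q.1 q.2 a ν) = 0)
    (hunit : ∀ q ∈ Ω, (∑ μ, ∑ ν, g (φ q.1 q.2) μ ν * nrm q.1 q.2 μ * nrm q.1 q.2 ν) = ϵ) :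
    IsHypersurfaceFamily (fun z => formOf (g z)) (fun z => bilinOf (christoffel g z))
      (fun q => φ q.1 q.2) (fun q => nrm q.1 q.2) (coordDir (n := n)) ϵ Ω where
  isOpen := hΩ
  contDiffAt_map q hq := contDiffAt_pi.2 (hφ q hq)
  contDiffAt_normal q hq := contDiffAt_pi.2 (hnrm q hq)
  differentiableAt_metric q hq := (hasFDerivAt_formOf fun μ ν =>
    (hg _ (hφV q hq) μ ν).differentiableAt (by norm_num)).1
  differentiableAt_christoffel q hq := (hasFDerivAt_bilinOf
    (differentiableAt_christoffel (hg _ (hφV q hq)) (hgunit _ (hφV q hq)))).1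
  metric_symm q hq u v := by
    simp only [formOf_apply]
    rw [Finset.sum_comm]
    refine Finset.sum_congr rfl fun i _ => Finset.sum_congr rfl fun j _ => ?_
    rw [hgsym _ (hφV q hq)]
    ring
  christoffel_symm q hq u v := by
    ext l
    simp only [bilinOf_apply]
    rw [Finset.sum_comm]
    refine Finset.sum_congr rfl fun i _ => Finset.sum_congr rfl fun j _ => ?_
    rw [christoffel_symm hV hgsym (hφV q hq)]
    ring
  compat q hq := metric_compat hV hgsym (hφV q hq) (hgunit _ (hφV q hq)) fun μ ν =>
    (hg _ (hφV q hq) μ ν).differentiableAt (by norm_num)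
  orth q hq a := by
    rw [formOf_apply, ← horth q hq a]
    simp only [Dphi_eq_fderiv ((contDiffAt_pi.2 (hφ q hq)).differentiableAt (by norm_num))]
  unit q hq := by
    rw [formOf_apply, hunit q hq]
  spatial a := rfl

end Coordinates
/-- Lemma 5.6 (2) of the paper, in local coordinates: the first
variation of the mean curvature is
`∂_t k_t|_{t=0} = −f Tr_h(K²) − f Ric(n,n) − ϵ Δ^Σ f + dk·X`. -/
theorem first_variation_mean_curvature
    (n : ℕ) (hn : 1 ≤ n)
    (U : Set (Fin n → ℝ)) (hU : IsOpen U)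
    (V : Set (Fin (n + 1) → ℝ)) (hV : IsOpen V)
    (g : (Fin (n + 1) → ℝ) → Fin (n + 1) → Fin (n + 1) → ℝ)
    (hg : ∀ μ ν, ContDiffOn ℝ (⊤ : ℕ∞) (fun x => g x μ ν) V)
    (hgsym : ∀ x ∈ V, ∀ μ ν, g x μ ν = g x ν μ)
    (hgunit : ∀ x ∈ V, IsUnit (Matrix.of (g x)).det)
    (δ : ℝ) (hδ : 0 < δ)
    (φ : ℝ → (Fin n → ℝ) → Fin (n + 1) → ℝ)
    (hφ : ∀ μ, ContDiffOn ℝ (⊤ : ℕ∞) (fun q : ℝ × (Fin n → ℝ) => φ q.1 q.2 μ)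
      (Set.Ioo (-δ) δ ×ˢ U))
    (hφV : ∀ t ∈ Set.Ioo (-δ) δ, ∀ y ∈ U, φ t y ∈ V)
    (himm : ∀ t ∈ Set.Ioo (-δ) δ, ∀ y ∈ U, ∀ v : Fin n → ℝ,
      (∀ μ, (∑ a, v a * Dphi φ t y a μ) = 0) → v = 0)
    (nrm : ℝ → (Fin n → ℝ) → Fin (n + 1) → ℝ)
    (hnrm : ∀ μ, ContDiffOn ℝ (⊤ : ℕ∞) (fun q : ℝ × (Fin n → ℝ) => nrm q.1 q.2 μ)
      (Set.Ioo (-δ) δ ×ˢ U))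
    (ϵ : ℝ) (hϵ : ϵ = 1 ∨ ϵ = -1)
    (horth : ∀ t ∈ Set.Ioo (-δ) δ, ∀ y ∈ U, ∀ a : Fin n,
      (∑ μ, ∑ ν, g (φ t y) μ ν * nrm t y μ * Dphi φ t y a ν) = 0)
    (hunit : ∀ t ∈ Set.Ioo (-δ) δ, ∀ y ∈ U,
      (∑ μ, ∑ ν, g (φ t y) μ ν * nrm t y μ * nrm t y ν) = ϵ)
    (f : (Fin n → ℝ) → ℝ) (hf : ContDiffOn ℝ (⊤ : ℕ∞) f U)
    (X : (Fin n → ℝ) → Fin n → ℝ) (hX : ∀ a, ContDiffOn ℝ (⊤ : ℕ∞) (fun y => X y a) U)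
    (hdec : ∀ y ∈ U, ∀ μ, deriv (fun t => φ t y μ) 0
      = f y * nrm 0 y μ + ∑ a, X y a * Dphi φ 0 y a μ)
    (hh0 : ∀ y ∈ U, IsUnit (Matrix.of (fun a b => indMet g φ 0 y a b)).det) :
    ∀ y ∈ U,
      deriv (fun t => trExtK g φ nrm t y) 0
        = -f y * (∑ a, ∑ b, ∑ c, ∑ d, indMetInv g φ 0 y a b * extK g φ nrm 0 y b c
              * indMetInv g φ 0 y c d * extK g φ nrm 0 y d a)
          - f y * (∑ α, ∑ β, ricci g (φ 0 y) α β * nrm 0 y α * nrm 0 y β)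
          - ϵ * (∑ a, ∑ b, indMetInv g φ 0 y a b
              * (pder (fun z => pder f b z) a y
                - ∑ c, christoffelInd g φ y c a b * pder f c y))
          + ∑ a, X y a * pder (fun z => trExtK g φ nrm 0 z) a y := by
  intro y hy
  have hϵ2 : ϵ * ϵ = 1 := by rcases hϵ with rfl | rfl <;> norm_num
  have hΩ : IsOpen (Set.Ioo (-δ) δ ×ˢ U) := isOpen_Ioo.prod hU
  have hle : (2 : WithTop ℕ∞) ≤ ((⊤ : ℕ∞) : WithTop ℕ∞) :=
    WithTop.coe_le_coe.2 (le_top : (2 : ℕ∞) ≤ ⊤)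
  have hgat : ∀ x ∈ V, ∀ μ ν, ContDiffAt ℝ 2 (fun z => g z μ ν) x := fun x hx μ ν =>
    ((hg μ ν).contDiffAt (hV.mem_nhds hx)).of_le hle
  have hfat : ∀ z ∈ U, ContDiffAt ℝ 2 f z := fun z hz =>
    (hf.contDiffAt (hU.mem_nhds hz)).of_le hle
  have hXat : ∀ z ∈ U, ∀ b, DifferentiableAt ℝ (fun z => X z b) z := fun z hz b =>
    (((hX b).contDiffAt (hU.mem_nhds hz)).of_le hle).differentiableAt (by norm_num)
  set Ω := Set.Ioo (-δ) δ ×ˢ U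
  have h0 : (0 : ℝ) ∈ Set.Ioo (-δ) δ := ⟨by linarith, hδ⟩
  have hq : ((0, y) : ℝ × (Fin n → ℝ)) ∈ Ω := ⟨h0, hy⟩
  have S := isHypersurfaceFamily_coord hV hgat hgsym hgunit hΩ
    (fun q hq μ => ((hφ μ).contDiffAt (hΩ.mem_nhds hq)).of_le hle)
    (fun q hq => hφV q.1 hq.1 q.2 hq.2)
    (fun q hq μ => ((hnrm μ).contDiffAt (hΩ.mem_nhds hq)).of_le hle)
    (fun q hq => horth q.1 hq.1 q.2 hq.2) (fun q hq => hunit q.1 hq.1 q.2 hq.2)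
  have hDphi : ∀ q ∈ Ω, ∀ a μ, Dphi φ q.1 q.2 a μ
      = fderiv ℝ (fun q => φ q.1 q.2) q (coordDir a) μ := fun q hq a μ =>
    Dphi_eq_fderiv (S.differentiableAt_map hq) a μ
  set Φ : ℝ × (Fin n → ℝ) → Fin (n + 1) → ℝ := fun q => φ q.1 q.2 with hΦdef
  set N : ℝ × (Fin n → ℝ) → Fin (n + 1) → ℝ := fun q => nrm q.1 q.2 with hNdef
  set G := fun z => formOf (g z) with hGdef
  set Γ := fun z => bilinOf (christoffel g z)
  set h : ℝ × (Fin n → ℝ) → Matrix (Fin n) (Fin n) ℝ := fun q => Matrix.of fun a b =>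
    G (Φ q) (fderiv ℝ Φ q (coordDir a)) (fderiv ℝ Φ q (coordDir b)) with hhdef
  set K : ℝ × (Fin n → ℝ) → Matrix (Fin n) (Fin n) ℝ := fun q => Matrix.of fun a b =>
    G (Φ q) (fderiv ℝ Φ q (coordDir a)) (covDeriv Γ Φ N (coordDir b) q)
  have hind : ∀ q ∈ Ω, ∀ a b, indMet g φ q.1 q.2 a b = h q a b := by
    intro q hq a b
    simp only [indMet, hDphi q hq, hhdef, Matrix.of_apply, hGdef, formOf_apply, hΦdef]
  have hinv : ∀ q ∈ Ω, ∀ a b, indMetInv g φ q.1 q.2 a b = (h q)⁻¹ a b := by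
    intro q hq a b
    have : (Matrix.of fun a b => indMet g φ q.1 q.2 a b) = h q := Matrix.ext (hind q hq)
    rw [indMetInv, this]
  have hext : ∀ q ∈ Ω, ∀ a b, extK g φ nrm q.1 q.2 a b = K q a b := by
    intro q hq a b
    rw [extK_eq hV hgsym (hφV q.1 hq.1 q.2 hq.2) (S.differentiableAt_map hq)
      (S.differentiableAt_normal hq)]
    rfl
  have hKsymm : ∀ q ∈ Ω, ∀ a b, K q a b = K q b a := fun q hq a b => S.extrinsic_symm hq a b
  have htr : ∀ q ∈ Ω, trExtK g φ nrm q.1 q.2 = ∑ a, ∑ b, (h q)⁻¹ a b * K q b a := by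
    intro q hq
    simp only [trExtK, hinv q hq, hext q hq, hKsymm q hq]
  have hdet : IsUnit (h (0, y)).det := by
    have : (Matrix.of fun a b => indMet g φ 0 y a b) = h (0, y) := Matrix.ext (hind _ hq)
    exact this ▸ hh0 y hy
  have hHh : (h (0, y))⁻¹ * h (0, y) = 1 := Matrix.nonsing_inv_mul _ hdet
  have hhd : ∀ a b, DifferentiableAt ℝ (fun q => h q a b) (0, y) := fun a b =>
    S.differentiableAt_inner hq (S.differentiableAt_fderiv_map hq _)
      (S.differentiableAt_fderiv_map hq _)
  have hHd := differentiableAt_matrix_inv hhd hdet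
  have hKd : ∀ a b, DifferentiableAt ℝ (fun q => K q a b) (0, y) := fun a b =>
    S.differentiableAt_inner hq (S.differentiableAt_fderiv_map hq _)
      (S.differentiableAt_covDeriv_normal hq _)
  have hHKd : ∀ a b, DifferentiableAt ℝ (fun q => (h q)⁻¹ a b * K q b a) (0, y) := fun a b =>
    (hHd a b).mul (hKd b a)
  have hHKd' : ∀ a, DifferentiableAt ℝ (fun q => ∑ b, (h q)⁻¹ a b * K q b a) (0, y) := fun a =>
    DifferentiableAt.fun_sum fun b _ => hHKd a b
  have hkd : DifferentiableAt ℝ (fun q => ∑ a, ∑ b, (h q)⁻¹ a b * K q b a) (0, y) :=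
    DifferentiableAt.fun_sum fun a _ => hHKd' a
  set T : ℝ × (Fin n → ℝ) := (1, 0) - ∑ a, X y a • coordDir a with hT
  -- The variation field `f N + Σ (X^b - X^b(y)) ∂_bΦ` in the fixed parameter direction `T`.
  have hf' : ∀ p ∈ Ω, ContDiffAt ℝ 2 (fun q : ℝ × (Fin n → ℝ) => f q.2) p := fun p hp =>
    ContDiffAt.comp (g := f) p (hfat p.2 hp.2) contDiffAt_snd
  have hX' : ∀ p ∈ Ω, ∀ b,
      DifferentiableAt ℝ (fun q : ℝ × (Fin n → ℝ) => X q.2 b - X y b) p := fun p hp b =>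
    (DifferentiableAt.comp (g := fun z => X z b) p (hXat p.2 hp.2 b)
      differentiableAt_snd).sub_const _
  have hdec' : ∀ p ∈ Ω, p.1 = ((0, y) : ℝ × (Fin n → ℝ)).1 → fderiv ℝ Φ p T = f p.2 • N p
      + ∑ b, (X p.2 b - X y b) • fderiv ℝ Φ p (coordDir b) := by
    rintro ⟨t, z⟩ hp rfl
    have h1 : fderiv ℝ Φ (0, z) (1, 0)
        = f z • N (0, z) + ∑ b, X z b • fderiv ℝ Φ (0, z) (coordDir b) := by
      ext μ
      rw [← fderiv_apply_eq (S.differentiableAt_map hp),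
        ← deriv_slice_eq (A := fun t z => φ t z μ) hΩ hp
          (differentiableAt_pi.1 (S.differentiableAt_map hp) μ) (fun _ _ => rfl), hdec z hp.2]
      have := fun a => hDphi (0, z) hp a μ
      simp only at this
      simp [this, hNdef]
    rw [hT, map_sub, h1]
    simp only [map_sum, map_smul, sub_smul, Finset.sum_sub_distrib]
    abel
  have hX0 : ∀ b, X ((0, y) : ℝ × (Fin n → ℝ)).2 b - X y b = 0 := fun b => sub_self _
  have hdf : ∀ p ∈ Ω, ∀ a, pder f a p.2
      = fderiv ℝ (fun q : ℝ × (Fin n → ℝ) => f q.2) p (coordDir a) := fun p hp a =>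
    pder_slice_eq (A := fun _ z => f z) hΩ hp ((hf' p hp).differentiableAt (by norm_num))
      (fun _ _ => rfl) a
  have hddf : ∀ a b, pder (fun z => pder f b z) a y
      = fderiv ℝ (fun p => fderiv ℝ (fun q : ℝ × (Fin n → ℝ) => f q.2) p (coordDir b)) (0, y)
        (coordDir a) := fun a b =>
    pder_slice_eq (A := fun _ z => pder f b z) hΩ hq
      ((contDiffAt_fderiv_apply (m := 1) (hf' _ hq) (by norm_num) _).differentiableAt
        (by norm_num)) (fun p hp => hdf p hp b) a
  have hchr : ∀ c a b, christoffelInd g φ y c a b = ∑ d, (h (0, y))⁻¹ c d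
      * G (Φ (0, y)) (fderiv ℝ Φ (0, y) (coordDir d))
        (covDeriv Γ Φ (fun p => fderiv ℝ Φ p (coordDir b)) (coordDir a) (0, y)) := by
    intro c a b
    have hp : ∀ a b c, pder (fun z => indMet g φ 0 z a b) c y
        = fderiv ℝ (fun q => h q a b) (0, y) (coordDir c) := fun a b c =>
      pder_slice_eq (A := fun t z => indMet g φ t z a b) hΩ hq (hhd a b)
        (fun p hp => hind p hp a b) c
    rw [christoffelInd, Finset.mul_sum]
    refine Finset.sum_congr rfl fun d _ => ?_
    rw [hp, hp, hp, ← S.koszul hq, hinv (0, y) hq c d]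
    simp only [hhdef, Matrix.of_apply]
    ring
  have hmain := trace_variation hHh (fderiv_matrix_inv_mul hhd hdet T)
    (K := K (0, y)) (f := f y)
    (K' := Matrix.of fun a b => fderiv ℝ (fun q => K q a b) (0, y) T)
    (B := Matrix.of fun a c => fderiv ℝ (fun q : ℝ × (Fin n → ℝ) => X q.2 c - X y c) (0, y)
      (coordDir a))
    (S := Matrix.of fun a b => f y * G (Φ (0, y)) (fderiv ℝ Φ (0, y) (coordDir a))
        (curvOp Γ (Φ (0, y)) (N (0, y)) (fderiv ℝ Φ (0, y) (coordDir b)) (N (0, y)))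
      - ϵ * (pder (fun z => pder f a z) b y
        - ∑ c, christoffelInd g φ y c b a * pder f c y))
    (by
      ext a b
      simp only [Matrix.add_apply, Matrix.smul_apply, Matrix.mul_apply, Matrix.transpose_apply,
        Matrix.of_apply, smul_eq_mul]
      exact S.fderiv_indMet hq ((hf' _ hq).differentiableAt (by norm_num)) (hX' _ hq) hdec' hX0 a b)
    (by
      ext a b
      simp only [Matrix.add_apply, Matrix.smul_apply, Matrix.mul_apply, Matrix.transpose_apply,
        Matrix.of_apply, smul_eq_mul, hchr, hddf, fun c => hdf (0, y) hq c]
      have hsum : ∑ d, (∑ c, K (0, y) a c * (h (0, y))⁻¹ c d) * K (0, y) d b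
          = ∑ c, ∑ d, K (0, y) a c * (h (0, y))⁻¹ c d * K (0, y) d b := by
        simp only [Finset.sum_mul]
        exact Finset.sum_comm
      rw [hsum]
      exact S.fderiv_extrinsic (by simp) hϵ2 hq hHh hf' hX' hdec' hX0 a b)
  have hkT : fderiv ℝ (fun q => ∑ a, ∑ b, (h q)⁻¹ a b * K q b a) (0, y) T
      = (Matrix.of (fun i j => fderiv ℝ (fun z => (h z)⁻¹ i j) (0, y) T) * K (0, y)).trace
        + ((h (0, y))⁻¹ * Matrix.of fun a b => fderiv ℝ (fun q => K q a b) (0, y) T).trace := by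
    rw [fderiv_fun_sum fun a _ => hHKd' a]
    simp only [fderiv_fun_sum fun b _ => hHKd _ b, sum_apply, fderiv_fun_mul (hHd _ _) (hKd _ _),
      add_apply, smul_apply, smul_eq_mul, Matrix.trace, Matrix.diag, Matrix.mul_apply,
      Matrix.of_apply, ← Finset.sum_add_distrib]
    exact Finset.sum_congr rfl fun _ _ => Finset.sum_congr rfl fun _ _ => by ring
  have hric : ∑ a, ∑ b, (h (0, y))⁻¹ a b * G (Φ (0, y)) (fderiv ℝ Φ (0, y) (coordDir b))
        (curvOp Γ (Φ (0, y)) (N (0, y)) (fderiv ℝ Φ (0, y) (coordDir a)) (N (0, y)))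
      = -∑ α, ∑ β, ricci g (φ 0 y) α β * nrm 0 y α * nrm 0 y β := by
    let L : (Fin (n + 1) → ℝ) →ₗ[ℝ] (Fin (n + 1) → ℝ) :=
      { toFun := fun v => curvOp Γ (Φ (0, y)) (N (0, y)) v (N (0, y))
        map_add' := fun u v => by simp [curvOp]; abel
        map_smul' := fun c v => by simp [curvOp, smul_add, smul_sub] }
    have hL := sum_apply_single_eq (S.metric_symm _ hq) (S.orth _ hq) (S.unit _ hq)
      hϵ2 hHh L
    have hLN : L (N (0, y)) = 0 := curvOp_self _ _ _ _
    rw [hLN, map_zero, mul_zero, add_zero] at hL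
    rw [sum_ricci_eq (hgat _ (hφV 0 h0 y hy)) (hgunit _ (hφV 0 h0 y hy)) (nrm 0 y), neg_neg]
    exact hL.symm
  have hlhs := deriv_slice_eq (A := fun t z => trExtK g φ nrm t z) hΩ hq hkd htr
  have hrhs := pder_slice_eq (A := fun t z => trExtK g φ nrm t z) hΩ hq hkd htr
  have hTk := hkT
  rw [hT, map_sub, map_sum] at hTk
  simp only [map_smul, smul_eq_mul, ← hlhs, ← hrhs] at hTk
  rw [← hT, hmain] at hTk
  have hKK : ((h (0, y))⁻¹ * K (0, y) * (h (0, y))⁻¹ * K (0, y)).trace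
      = ∑ a, ∑ b, ∑ c, ∑ d, indMetInv g φ 0 y a b * extK g φ nrm 0 y b c
        * indMetInv g φ 0 y c d * extK g φ nrm 0 y d a := by
    rw [trace_mul_mul_mul]
    simp only [hinv (0, y) hq, hext (0, y) hq]
  have hHS : ((h (0, y))⁻¹ * Matrix.of fun a b => f y * G (Φ (0, y))
        (fderiv ℝ Φ (0, y) (coordDir a))
        (curvOp Γ (Φ (0, y)) (N (0, y)) (fderiv ℝ Φ (0, y) (coordDir b)) (N (0, y)))
      - ϵ * (pder (fun z => pder f a z) b y
        - ∑ c, christoffelInd g φ y c b a * pder f c y)).trace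
      = -f y * (∑ α, ∑ β, ricci g (φ 0 y) α β * nrm 0 y α * nrm 0 y β)
        - ϵ * (∑ a, ∑ b, indMetInv g φ 0 y a b
          * (pder (fun z => pder f b z) a y
            - ∑ c, christoffelInd g φ y c a b * pder f c y)) := by
    rw [neg_mul, ← mul_neg, ← hric]
    simp only [hinv (0, y) hq, Matrix.trace, Matrix.diag, Matrix.mul_apply, Matrix.of_apply]
    rw [Finset.mul_sum, Finset.mul_sum, ← Finset.sum_sub_distrib]
    refine Finset.sum_congr rfl fun a _ => ?_
    rw [Finset.mul_sum, Finset.mul_sum, ← Finset.sum_sub_distrib]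
    exact Finset.sum_congr rfl fun b _ => by ring
  rw [hKK, hHS] at hTk
  linear_combination hTk
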